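/- Let n ≥ 3 and let N be a nontrivial normal subgroup of B_n with N ⊆ [B_n, B_n]. Then the Dehornoy ordering restricted to N is dense (N has no least positive element). -/

import Mathlib

/-- The braid relations on generators indexed by `Fin m` (generator `i` is `σ_{i+1}`). -/
def braidRels (m : ℕ) : Set (FreeGroup (Fin m)) :=
  {r | (∃ i j : Fin m, (i : ℕ) + 1 < (j : ℕ) ∧
        r = FreeGroup.of i * FreeGroup.of j * (FreeGroup.of i)⁻¹ * (FreeGroup.of j)⁻¹) ∨
       (∃ i j : Fin m, (i : ℕ) + 1 = (j : ℕ) ∧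
        r = FreeGroup.of i * FreeGroup.of j * FreeGroup.of i *
            (FreeGroup.of j * FreeGroup.of i * FreeGroup.of j)⁻¹)}

/-- The Artin braid group `B_n`, presented with generators `σ₁, …, σ_{n-1}`. -/
abbrev BraidGroup (n : ℕ) := PresentedGroup (braidRels (n - 1))

/-- The Artin generator; `braidGen i` represents `σ_{i+1}`. -/
def braidGen {n : ℕ} (i : Fin (n - 1)) : BraidGroup n := PresentedGroup.of i

/-- `σ_k` (1-indexed), or `1` if out of range. -/
def sigma' (n k : ℕ) : BraidGroup n :=
  if h : k - 1 < n - 1 then braidGen ⟨k - 1, h⟩ else 1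

/-- A braid is `i`-positive (`i : Fin (n-1)` standing for `σ_{i+1}`) if it is represented by
a word using only generators of index ≤ i, in which generator `i` occurs, and only with
positive exponent. -/
def IsIPositive {n : ℕ} (β : BraidGroup n) (i : Fin (n - 1)) : Prop :=
  ∃ w : FreeGroup (Fin (n - 1)), PresentedGroup.mk (braidRels (n - 1)) w = β ∧
    (∀ l ∈ w.toWord, l.1 ≤ i ∧ (l.1 = i → l.2 = true)) ∧ (∃ l ∈ w.toWord, l.1 = i)

/-- A braid is `i`-negative if its inverse is `i`-positive. -/
def IsINegative {n : ℕ} (β : BraidGroup n) (i : Fin (n - 1)) : Prop :=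
  IsIPositive β⁻¹ i

/-- Dehornoy-positive braids: `i`-positive for some `i`. -/
def DPos {n : ℕ} (β : BraidGroup n) : Prop := ∃ i, IsIPositive β i

/-- The Dehornoy ordering on `B_n`. -/
def DLt {n : ℕ} (a b : BraidGroup n) : Prop := DPos (a⁻¹ * b)

/-- The copy of `B_r` inside `B_n` generated by `σ₁, …, σ_{r-1}`. -/
def braidSub (n r : ℕ) : Subgroup (BraidGroup n) :=
  Subgroup.closure {β | ∃ i : Fin (n - 1), (i : ℕ) < r - 1 ∧ β = braidGen i}

/-- `σ_a σ_{a-1} ⋯ σ_b` (1-indexed). -/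
def descSeg (n a b : ℕ) : BraidGroup n :=
  (((List.range (a - b + 1)).map fun j => sigma' n (a - j)).prod)

/-- The Garside half twist `Δ_k = (σ_{k-1}⋯σ₁)(σ_{k-1}⋯σ₂)⋯(σ_{k-1}σ_{k-2})(σ_{k-1})`
viewed in `B_n`. -/
def Delta (n k : ℕ) : BraidGroup n :=
  (((List.range (k - 1)).map fun m => descSeg n (k - 1) (m + 1)).prod)


namespace DOrd

section Abstract

variable {G : Type*} [Group G] (s : ℕ → G)

/-- subgroup generated by the first `k` generators -/
def H (k : ℕ) : Subgroup G := Subgroup.closure {g | ∃ j, j < k ∧ g = s j}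

/-- monoid generated by `H k` and `s k` -/
def Q (k : ℕ) : Submonoid G := Submonoid.closure ((H s k : Set G) ∪ {s k})

/-- `k`-positive elements -/
def P (k : ℕ) : Set G := {g | ∃ x ∈ Q s k, ∃ y ∈ Q s k, g = x * s k * y}

def A : ℕ → G
  | 0 => 1
  | k + 1 => s k * A k * s k

def D : ℕ → G
  | 0 => 1
  | k + 1 => D k * A s (k + 1)

def d : ℕ → G
  | 0 => 1
  | k + 1 => d k * s k

variable {s}

lemma s_mem_H {j k : ℕ} (h : j < k) : s j ∈ H s k := Subgroup.subset_closure ⟨j, h, rfl⟩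

lemma H_mono {j k : ℕ} (h : j ≤ k) : H s j ≤ H s k :=
  Subgroup.closure_mono (fun _ ⟨i, hi, e⟩ => ⟨i, hi.trans_le h, e⟩)

lemma H_le_Q {k : ℕ} {g : G} (h : g ∈ H s k) : g ∈ Q s k :=
  Submonoid.subset_closure (Or.inl h)

lemma s_mem_Q (k : ℕ) : s k ∈ Q s k := Submonoid.subset_closure (Or.inr rfl)

lemma Q_le_H {k : ℕ} {g : G} (h : g ∈ Q s k) : g ∈ H s (k + 1) := by
  have : Q s k ≤ (H s (k + 1)).toSubmonoid := by
    refine Submonoid.closure_le.2 ?_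
    rintro x (hx | hx)
    · exact H_mono (Nat.le_succ k) hx
    · rw [Set.mem_singleton_iff.1 hx]; exact s_mem_H (Nat.lt_succ_self k)
  exact this h

lemma P_le_Q {k : ℕ} {g : G} (h : g ∈ P s k) : g ∈ Q s k := by
  obtain ⟨x, hx, y, hy, rfl⟩ := h
  exact mul_mem (mul_mem hx (s_mem_Q k)) hy

lemma P_le_H {k : ℕ} {g : G} (h : g ∈ P s k) : g ∈ H s (k + 1) := Q_le_H (P_le_Q h)

lemma QP {k : ℕ} {g h : G} (hg : g ∈ Q s k) (hh : h ∈ P s k) : g * h ∈ P s k := by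
  obtain ⟨x, hx, y, hy, rfl⟩ := hh
  exact ⟨g * x, mul_mem hg hx, y, hy, by group⟩

lemma PQ {k : ℕ} {g h : G} (hg : g ∈ P s k) (hh : h ∈ Q s k) : g * h ∈ P s k := by
  obtain ⟨x, hx, y, hy, rfl⟩ := hg
  exact ⟨x, hx, y * h, mul_mem hy hh, by group⟩

lemma s_mem_P (k : ℕ) : s k ∈ P s k := ⟨1, one_mem _, 1, one_mem _, by simp⟩

lemma Q_cases {k : ℕ} {g : G} (h : g ∈ Q s k) : g ∈ H s k ∨ g ∈ P s k := by
  induction h using Submonoid.closure_induction with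
  | mem x hx =>
    rcases hx with hx | hx
    · exact Or.inl hx
    · rw [Set.mem_singleton_iff.1 hx]; exact Or.inr (s_mem_P k)
  | one => exact Or.inl (one_mem _)
  | mul x y _ _ hx hy =>
    rcases hx with hx | hx
    · rcases hy with hy | hy
      · exact Or.inl (mul_mem hx hy)
      · exact Or.inr (QP (H_le_Q hx) hy)
    · rcases hy with hy | hy
      · exact Or.inr (PQ hx (H_le_Q hy))
      · exact Or.inr (PQ hx (P_le_Q hy))

lemma Q_left {k : ℕ} {g : G} (h : g ∈ Q s k) :
    g ∈ H s k ∨ ∃ u ∈ H s k, ∃ v ∈ Q s k, g = u * s k * v := by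
  induction h using Submonoid.closure_induction with
  | mem x hx =>
    rcases hx with hx | hx
    · exact Or.inl hx
    · rw [Set.mem_singleton_iff.1 hx]; exact Or.inr ⟨1, one_mem _, 1, one_mem _, by simp⟩
  | one => exact Or.inl (one_mem _)
  | mul x y _ hy' hx hy =>
    rcases hx with hx | ⟨u, hu, v, hv, rfl⟩
    · rcases hy with hy | ⟨u, hu, v, hv, rfl⟩
      · exact Or.inl (mul_mem hx hy)
      · exact Or.inr ⟨x * u, mul_mem hx hu, v, hv, by group⟩
    · exact Or.inr ⟨u, hu, v * y, mul_mem hv hy', by group⟩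

lemma Q_right {k : ℕ} {g : G} (h : g ∈ Q s k) :
    g ∈ H s k ∨ ∃ u ∈ H s k, ∃ v ∈ Q s k, g = v * s k * u := by
  induction h using Submonoid.closure_induction with
  | mem x hx =>
    rcases hx with hx | hx
    · exact Or.inl hx
    · rw [Set.mem_singleton_iff.1 hx]; exact Or.inr ⟨1, one_mem _, 1, one_mem _, by simp⟩
  | one => exact Or.inl (one_mem _)
  | mul x y hx' _ hx hy =>
    rcases hy with hy | ⟨u, hu, v, hv, rfl⟩
    · rcases hx with hx | ⟨u, hu, v, hv, rfl⟩
      · exact Or.inl (mul_mem hx hy)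
      · exact Or.inr ⟨u * y, mul_mem hu hy, v, hv, by group⟩
    · exact Or.inr ⟨u, hu, x * v, mul_mem hx' hv, by group⟩

lemma P_left {k : ℕ} {g : G} (h : g ∈ P s k) :
    ∃ u ∈ H s k, ∃ v ∈ Q s k, g = u * s k * v := by
  obtain ⟨x, hx, y, hy, rfl⟩ := h
  rcases Q_left hx with hx | ⟨u, hu, v, hv, rfl⟩
  · exact ⟨x, hx, y, hy, rfl⟩
  · exact ⟨u, hu, v * s k * y, mul_mem (mul_mem hv (s_mem_Q k)) hy, by group⟩

lemma P_right {k : ℕ} {g : G} (h : g ∈ P s k) :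
    ∃ u ∈ H s k, ∃ v ∈ Q s k, g = v * s k * u := by
  obtain ⟨x, hx, y, hy, rfl⟩ := h
  rcases Q_right hy with hy | ⟨u, hu, v, hv, rfl⟩
  · exact ⟨y, hy, x, hx, rfl⟩
  · exact ⟨u, hu, x * s k * v, mul_mem (mul_mem hx (s_mem_Q k)) hv, by group⟩

lemma A_mem (k : ℕ) : A s k ∈ H s k := by
  induction k with
  | zero => exact one_mem _
  | succ k ih =>
    have := s_mem_H (s := s) (Nat.lt_succ_self k)
    exact mul_mem (mul_mem this (H_mono (Nat.le_succ k) ih)) this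

lemma D_mem (k : ℕ) : D s k ∈ H s k := by
  induction k with
  | zero => exact one_mem _
  | succ k ih => exact mul_mem (H_mono (Nat.le_succ k) ih) (A_mem _)

lemma d_mem (k : ℕ) : d s k ∈ H s k := by
  induction k with
  | zero => exact one_mem _
  | succ k ih => exact mul_mem (H_mono (Nat.le_succ k) ih) (s_mem_H (Nat.lt_succ_self k))

lemma commute_H {k : ℕ} {x : G} (h : ∀ j < k, Commute x (s j)) {g : G} (hg : g ∈ H s k) :
    Commute x g := by
  induction hg using Subgroup.closure_induction with
  | mem y hy => obtain ⟨j, hj, rfl⟩ := hy; exact h j hj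
  | one => exact Commute.one_right x
  | mul a b _ _ ha hb => exact ha.mul_right hb
  | inv a _ ha => exact ha.inv_right

variable {m : ℕ}

lemma s_comm
    (hc : ∀ i j, i + 1 < j → Commute (s i) (s j))
    {k j : ℕ} (h : k < j) {g : G} (hg : g ∈ H s k) : Commute (s j) g :=
  commute_H (fun i hi => (hc i j (by omega)).symm) hg

lemma A_comm
    (hc : ∀ i j, i + 1 < j → Commute (s i) (s j))
    (hb : ∀ i, i + 1 < m → s i * s (i + 1) * s i = s (i + 1) * s i * s (i + 1))
    (k : ℕ) (hk : k < m) : ∀ j < k, Commute (A s (k + 1)) (s j) := by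
  intro j hj
  rcases Nat.lt_or_ge (j + 1) k with h | h
  · obtain ⟨k, rfl⟩ : ∃ k', k = k' + 1 := ⟨k - 1, by omega⟩
    have h1 : Commute (A s (k + 1)) (s j) := A_comm hc hb k (by omega) j (by omega)
    have h2 : Commute (s (k + 1)) (s j) := (hc j (k + 1) h).symm
    exact (h2.mul_left h1).mul_left h2
  · obtain rfl : k = j + 1 := by omega
    have e := hb j hk
    have h1 : Commute (s (j + 1)) (A s j) := s_comm hc (by omega) (A_mem j)
    have h1' := h1.eq
    change (s (j+1) * (s j * A s j * s j) * s (j+1)) * s j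
      = s j * (s (j+1) * (s j * A s j * s j) * s (j+1))
    calc (s (j+1) * (s j * A s j * s j) * s (j+1)) * s j
        = s (j+1) * s j * A s j * (s j * s (j+1) * s j) := by group
      _ = s (j+1) * s j * (A s j * s (j+1)) * s j * s (j+1) := by rw [e]; group
      _ = (s (j+1) * s j * s (j+1)) * A s j * s j * s (j+1) := by rw [← h1']; group
      _ = _ := by rw [← e]; group
termination_by k

lemma D_comm
    (hc : ∀ i j, i + 1 < j → Commute (s i) (s j))
    (hb : ∀ i, i + 1 < m → s i * s (i + 1) * s i = s (i + 1) * s i * s (i + 1))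
    (k : ℕ) (hk : k ≤ m) : ∀ j < k, Commute (D s k) (s j) := by
  induction k with
  | zero => intro j hj; omega
  | succ k ih =>
    intro j hj
    rcases Nat.lt_or_ge j k with h | h
    · exact (ih (by omega) j h).mul_left (A_comm hc hb k (by omega) j h)
    · obtain rfl : j = k := by omega
      cases j with
      | zero => 
        change Commute (1 * (s 0 * 1 * s 0)) (s 0)
        simp [Commute, SemiconjBy, mul_assoc]
      | succ k =>
        have h1 : Commute (A s (k+1+1)) (A s (k+1)) :=
          commute_H (A_comm hc hb (k+1) (by omega)) (A_mem _)
        have h2 : Commute (s (k+1)) (D s k) := s_comm hc (by omega) (D_mem k)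
        have h3 : Commute (s (k+1)) (A s (k+1) * A s (k+1+1)) := by
          have e : A s (k+1) * A s (k+1+1) = s (k+1) * A s (k+1) * s (k+1) * A s (k+1) :=
            h1.eq.symm
          change s (k+1) * (A s (k+1) * A s (k+1+1)) = (A s (k+1) * A s (k+1+1)) * s (k+1)
          rw [e]
          have e2 : A s (k+1) * (s (k+1) * A s (k+1) * s (k+1))
            = s (k+1) * A s (k+1) * s (k+1) * A s (k+1) := e
          calc s (k+1) * (s (k+1) * A s (k+1) * s (k+1) * A s (k+1))
            _ = s (k+1) * (A s (k+1) * (s (k+1) * A s (k+1) * s (k+1))) := by rw [e2]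
            _ = _ := by group
        have h4 := (h2.mul_right h3).symm
        rw [← mul_assoc] at h4
        exact h4

lemma D_central
    (hc : ∀ i j, i + 1 < j → Commute (s i) (s j))
    (hb : ∀ i, i + 1 < m → s i * s (i + 1) * s i = s (i + 1) * s i * s (i + 1))
    {k : ℕ} (hk : k ≤ m) {g : G} (hg : g ∈ H s k) : Commute (D s k) g :=
  commute_H (D_comm hc hb k hk) hg

lemma D_eq (k : ℕ) : D s (k+1) = D s k * s k * A s k * s k := by
  change D s k * (s k * A s k * s k) = _
  group

lemma D_mem_P (k : ℕ) : D s (k+1) ∈ P s k :=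
  ⟨D s k, H_le_Q (D_mem k), A s k * s k, mul_mem (H_le_Q (A_mem k)) (s_mem_Q k),
    by rw [D_eq]; group⟩

lemma d_conj
    (hc : ∀ i j, i + 1 < j → Commute (s i) (s j))
    (hb : ∀ i, i + 1 < m → s i * s (i + 1) * s i = s (i + 1) * s i * s (i + 1))
    (k : ℕ) (hk : k < m) : ∀ i < k, d s (k+1) * s i * (d s (k+1))⁻¹ = s (i+1) := by
  induction k with
  | zero => intro i hi; omega
  | succ k ih =>
    intro i hi
    change d s (k+1) * s (k+1) * s i * (d s (k+1) * s (k+1))⁻¹ = _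
    rcases Nat.lt_or_ge i k with h | h
    · rw [← ih (by omega) i h]
      have := (hc i (k+1) (by omega)).eq
      rw [mul_assoc (d s (k+1)), ← this]; group
    · obtain rfl : i = k := by omega
      have e := hb i hk
      have h2 : Commute (s (i+1)) (d s i) := s_comm hc (by omega) (d_mem i)
      change d s i * s i * s (i+1) * s i * (d s i * s i * s (i+1))⁻¹ = _
      rw [mul_inv_eq_iff_eq_mul]
      calc d s i * s i * s (i+1) * s i = d s i * (s i * s (i+1) * s i) := by group
        _ = (d s i * s (i+1)) * s i * s (i+1) := by rw [e]; group
        _ = _ := by rw [← h2.eq]; group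

lemma H_shift
    (hc : ∀ i j, i + 1 < j → Commute (s i) (s j))
    (hb : ∀ i, i + 1 < m → s i * s (i + 1) * s i = s (i + 1) * s i * s (i + 1))
    {k j : ℕ} (hk : k < m) (hj : j ≤ k) {g : G} (hg : g ∈ H s j) :
    d s (k+1) * g * (d s (k+1))⁻¹ ∈ H s (j+1) := by
  induction hg using Subgroup.closure_induction with
  | mem y hy =>
    obtain ⟨i, hi, rfl⟩ := hy
    rw [d_conj hc hb k hk i (by omega)]
    exact s_mem_H (by omega)
  | one => simp
  | mul a b _ _ ha hb => convert mul_mem ha hb using 1; group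
  | inv a _ ha => convert inv_mem ha using 1; group

lemma Q_shift
    (hc : ∀ i j, i + 1 < j → Commute (s i) (s j))
    (hb : ∀ i, i + 1 < m → s i * s (i + 1) * s i = s (i + 1) * s i * s (i + 1))
    {k j : ℕ} (hk : k < m) (hj : j < k) {g : G} (hg : g ∈ Q s j) :
    d s (k+1) * g * (d s (k+1))⁻¹ ∈ Q s (j+1) := by
  induction hg using Submonoid.closure_induction with
  | mem y hy =>
    rcases hy with hy | hy
    · exact H_le_Q (H_shift hc hb hk (by omega) hy)
    · rw [Set.mem_singleton_iff.1 hy, d_conj hc hb k hk j hj]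
      exact s_mem_Q _
  | one => simp
  | mul a b _ _ ha hb => convert mul_mem ha hb using 1; group

lemma P_shift
    (hc : ∀ i j, i + 1 < j → Commute (s i) (s j))
    (hb : ∀ i, i + 1 < m → s i * s (i + 1) * s i = s (i + 1) * s i * s (i + 1))
    {k j : ℕ} (hk : k < m) (hj : j < k) {g : G} (hg : g ∈ P s j) :
    d s (k+1) * g * (d s (k+1))⁻¹ ∈ P s (j+1) := by
  obtain ⟨x, hx, y, hy, rfl⟩ := hg
  refine ⟨_, Q_shift hc hb hk hj hx, _, Q_shift hc hb hk hj hy, ?_⟩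
  rw [← d_conj hc hb k hk j hj]; group

lemma notmem
    (hone : ∀ k < m, (1 : G) ∉ P s k)
    {k : ℕ} (hk : k < m) {g : G} (hg : g ∈ H s k) : g ∉ P s k := by
  intro h
  refine hone k hk ?_
  simpa using QP (H_le_Q (inv_mem hg)) h

lemma pos_low
    (hone : ∀ k < m, (1 : G) ∉ P s k)
    {k j : ℕ} (hj : j < m) {g : G} (hg : g ∈ H s k) (h : g ∈ P s j) : j < k := by
  by_contra hlt
  exact notmem hone hj (H_mono (by omega) hg) h

lemma tri
    (hone : ∀ k < m, (1 : G) ∉ P s k)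
    (htri : ∀ g : G, g = 1 ∨ (∃ k < m, g ∈ P s k) ∨ (∃ k < m, g⁻¹ ∈ P s k))
    {k : ℕ} {g : G} (hg : g ∈ H s (k+1)) :
    g ∈ H s k ∨ g ∈ P s k ∨ g⁻¹ ∈ P s k := by
  rcases htri g with rfl | ⟨j, hj, h⟩ | ⟨j, hj, h⟩
  · exact Or.inl (one_mem _)
  · have := pos_low hone hj hg h
    rcases Nat.lt_or_ge j k with hjk | hjk
    · exact Or.inl (H_mono hjk (P_le_H h))
    · obtain rfl : j = k := by omega
      exact Or.inr (Or.inl h)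
  · have := pos_low hone hj (inv_mem hg) h
    rcases Nat.lt_or_ge j k with hjk | hjk
    · exact Or.inl ((inv_mem_iff).1 (H_mono hjk (P_le_H h)))
    · obtain rfl : j = k := by omega
      exact Or.inr (Or.inr h)

lemma pow_mem_P {k : ℕ} {g : G} (hg : g ∈ P s k) {n : ℕ} (hn : 0 < n) : g ^ n ∈ P s k := by
  obtain ⟨n, rfl⟩ : ∃ n', n = n' + 1 := ⟨n - 1, by omega⟩
  rw [pow_succ]
  exact QP (pow_mem (P_le_Q hg) n) hg

lemma zpow_mem_P {k : ℕ} {g : G} (hg : g ∈ P s k) {n : ℤ} (hn : 0 < n) : g ^ n ∈ P s k := by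
  lift n to ℕ using hn.le
  rw [zpow_natCast]
  exact pow_mem_P hg (by omega)

lemma cofinal
    (hc : ∀ i j, i + 1 < j → Commute (s i) (s j))
    (hb : ∀ i, i + 1 < m → s i * s (i + 1) * s i = s (i + 1) * s i * s (i + 1))
    {k : ℕ} (hk : k < m) {g : G} (hg : g ∈ H s (k+1)) :
    ∃ n : ℕ, D s (k+1) ^ n * g ∈ P s k ∧ D s (k+1) ^ n * g⁻¹ ∈ P s k := by
  have key : ∀ a b : G, ∀ n n' : ℕ, a ∈ H s (k+1) → D s (k+1) ^ n * a ∈ P s k →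
      D s (k+1) ^ n' * b ∈ P s k → D s (k+1) ^ (n+n') * (a * b) ∈ P s k := by
    intro a b n n' ha h1 h2
    have hcm := ((D_central hc hb (k := k+1) hk ha).pow_left n').eq
    have : D s (k+1) ^ (n+n') * (a * b) = (D s (k+1) ^ n * a) * (D s (k+1) ^ n' * b) := by
      rw [pow_add]
      calc _ = D s (k+1) ^ n * (D s (k+1) ^ n' * a) * b := by group
        _ = _ := by rw [hcm]; group
    rw [this]
    exact PQ h1 (P_le_Q h2)
  induction hg using Subgroup.closure_induction with
  | mem y hy =>
    obtain ⟨j, hj, rfl⟩ := hy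
    refine ⟨1, ?_, ?_⟩
    · rw [pow_one]
      refine PQ (D_mem_P k) ?_
      rcases Nat.lt_or_ge j k with h | h
      · exact H_le_Q (s_mem_H h)
      · obtain rfl : j = k := by omega
        exact s_mem_Q _
    · rw [pow_one]
      rcases Nat.lt_or_ge j k with h | h
      · exact PQ (D_mem_P k) (H_le_Q (inv_mem (s_mem_H h)))
      · obtain rfl : j = k := by omega
        rw [D_eq, mul_inv_cancel_right]
        exact ⟨_, H_le_Q (D_mem j), _, H_le_Q (A_mem j), rfl⟩
  | one =>
    exact ⟨1, by simpa using D_mem_P k, by simpa using D_mem_P k⟩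
  | mul a b ha hb' h1 h2 =>
    obtain ⟨n, h1, h1'⟩ := h1
    obtain ⟨n', h2, h2'⟩ := h2
    refine ⟨n + n', key a b n n' ha h1 h2, ?_⟩
    rw [mul_inv_rev, add_comm n n']
    exact key _ _ n' n (inv_mem hb') h2' h1'
  | inv a _ h =>
    obtain ⟨n, h, h'⟩ := h
    exact ⟨n, h', by simpa using h⟩

lemma cent
    (hc : ∀ i j, i + 1 < j → Commute (s i) (s j))
    (hb : ∀ i, i + 1 < m → s i * s (i + 1) * s i = s (i + 1) * s i * s (i + 1))
    (hone : ∀ k < m, (1 : G) ∉ P s k)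
    (htri : ∀ g : G, g = 1 ∨ (∃ k < m, g ∈ P s k) ∨ (∃ k < m, g⁻¹ ∈ P s k))
    {k : ℕ} (hk : k + 1 < m) {b : G} (hbm : b ∈ H s (k+1+1))
    (hcb : ∀ g ∈ H s (k+1), Commute b g) :
    ∃ a : ℤ, ∃ z ∈ H s (k+1), b = D s (k+1+1) ^ a * z := by
  set K := k + 1 with hK
  set E := D s (K+1) with hE
  have hEc : ∀ g ∈ H s (K+1), Commute E g := fun g hg => D_central hc hb (by omega) hg
  have hEP : E ∈ P s K := D_mem_P K
  have hEm : E ∈ H s (K+1) := D_mem _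
  obtain ⟨n, hn1, hn2⟩ := cofinal hc hb hk hbm
  rw [← hE] at hn1 hn2
  obtain ⟨a, ha, hmax⟩ := Int.exists_greatest_of_bdd (P := fun a : ℤ => E ^ (-a) * b ∈ Q s K)
    ⟨n, by
      intro a ha
      by_contra hlt
      push Not at hlt
      have h1 : E ^ (-a) * b * (E ^ n * b⁻¹) ∈ P s K := QP ha hn2
      have e : E ^ (-a) * b * (E ^ n * b⁻¹) = E ^ ((n:ℤ) - a) := by
        have := ((hEc b hbm).pow_left n).eq
        calc _ = E ^ (-a) * (b * E ^ n) * b⁻¹ := by group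
          _ = _ := by rw [← this, ← zpow_natCast]; group
      rw [e] at h1
      have h2 := PQ h1 (P_le_Q (zpow_mem_P hEP (n := a - n) (by omega)))
      rw [← zpow_add] at h2
      exact hone K hk (by simpa using h2)⟩
    ⟨-(n:ℤ), by simpa using P_le_Q hn1⟩
  set c := E ^ (-a) * b with hcdef
  have hcm : c ∈ H s (K+1) := mul_mem (zpow_mem hEm _) hbm
  have hcc : ∀ g ∈ H s K, Commute c g := fun g hg =>
    ((hEc g (H_mono (by omega) hg)).zpow_left _).mul_left (hcb g hg)
  rcases Q_cases ha with h | h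
  · exact ⟨a, c, h, by rw [hcdef]; group⟩
  exfalso
  have hc'm : E⁻¹ * c ∈ H s (K+1) := mul_mem (inv_mem hEm) hcm
  have hnot : E⁻¹ * c ∉ Q s K := by
    intro h
    have := hmax (a+1) (by
      convert h using 1
      rw [hcdef]; group)
    omega
  have hc'P : (E⁻¹ * c)⁻¹ ∈ P s K := by
    rcases tri hone htri hc'm with h | h | h
    · exact absurd (H_le_Q h) hnot
    · exact absurd (P_le_Q h) hnot
    · exact h
  obtain ⟨u, hu, v, hv, e1⟩ := P_left h
  obtain ⟨w, hw, v', hv', e2⟩ := P_right hc'P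
  set t := A s K * s k with ht
  have htm : t ∈ H s K := mul_mem (A_mem K) (s_mem_H (by omega))
  set g := w⁻¹ * t * u⁻¹ with hg
  have hgm : g ∈ H s K := mul_mem (mul_mem (inv_mem hw) htm) (inv_mem hu)
  have e3 : c = g * c * g⁻¹ := by rw [← (hcc g hgm).eq]; group
  have hEE : E = v' * s K * t * s K * (v * g⁻¹) := by
    have : E = (E⁻¹ * c)⁻¹ * c := by
      have h1 : c⁻¹ * E * c = E := by
        rw [mul_assoc, (hEc c hcm).eq]; group
      rw [mul_inv_rev, inv_inv, h1]
    rw [this, e2]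
    nth_rewrite 1 [e3]
    rw [e1, hg]; group
  have hbr := hb k hk
  rw [← hK] at hbr
  have h5 : s K * t * s K = (D s K)⁻¹ * E * (s k * s K * (s k)⁻¹) := by
    have h6 : (s K)⁻¹ * s k * s K = s k * s K * (s k)⁻¹ := by
      rw [eq_mul_inv_iff_mul_eq, mul_assoc, mul_assoc, inv_mul_eq_iff_eq_mul, ← mul_assoc,
        hbr, mul_assoc, ← mul_assoc]
    rw [← h6, hE, D_eq K, ht]; group
  have h7 : E = E * (v' * (D s K)⁻¹ * s k * s K * ((s k)⁻¹ * v * g⁻¹)) := by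
    have hx : v' * (D s K)⁻¹ ∈ H s (K+1) :=
      mul_mem (Q_le_H hv') (H_mono (by omega) (inv_mem (D_mem K)))
    calc E = v' * (s K * t * s K) * (v * g⁻¹) := by nth_rewrite 1 [hEE]; group
      _ = (v' * (D s K)⁻¹ * E) * (s k * s K * (s k)⁻¹) * (v * g⁻¹) := by rw [h5]; group
      _ = _ := by rw [← (hEc _ hx).eq]; group
  have h8 : (1:G) = v' * (D s K)⁻¹ * s k * s K * ((s k)⁻¹ * v * g⁻¹) := by
    have := h7
    rwa [left_eq_mul, eq_comm] at this
  refine hone K hk ?_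
  have hsk : s k ∈ H s K := s_mem_H (by omega)
  exact ⟨_, mul_mem (mul_mem hv' (H_le_Q (inv_mem (D_mem K)))) (H_le_Q hsk), _,
    mul_mem (mul_mem (H_le_Q (inv_mem hsk)) hv) (H_le_Q (inv_mem hgm)), h8⟩

lemma H_one {g : G} (hg : g ∈ H s 1) : ∃ u : ℤ, g = s 0 ^ u := by
  have : H s 1 ≤ Subgroup.zpowers (s 0) := by
    refine (Subgroup.closure_le _).2 ?_
    rintro x ⟨j, hj, rfl⟩
    obtain rfl : j = 0 := by omega
    exact Subgroup.mem_zpowers _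
  obtain ⟨u, hu⟩ := Subgroup.mem_zpowers_iff.1 (this hg)
  exact ⟨u, hu.symm⟩

lemma e_A
    (e : G →* Multiplicative ℤ) (he : ∀ k < m, (e (s k)).toAdd = 1)
    (k : ℕ) (hk : k ≤ m) : 0 ≤ (e (A s k)).toAdd := by
  induction k with
  | zero => simp [A]
  | succ k ih =>
    have := ih (by omega)
    have h := he k hk
    simp only [A, map_mul, toAdd_mul, h]
    omega

lemma e_D
    (e : G →* Multiplicative ℤ) (he : ∀ k < m, (e (s k)).toAdd = 1)
    (k : ℕ) (hk : k ≤ m) : 0 ≤ (e (D s k)).toAdd := by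
  induction k with
  | zero => simp [D]
  | succ k ih =>
    have := ih (by omega)
    have h := e_A e he (k+1) hk
    simp only [D, map_mul, toAdd_mul]
    omega

lemma e_D'
    (e : G →* Multiplicative ℤ) (he : ∀ k < m, (e (s k)).toAdd = 1)
    (k : ℕ) (hk : k < m) : 0 < (e (D s (k+1))).toAdd := by
  have h1 := e_D e he k hk.le
  have h2 := e_A e he k hk.le
  have h := he k hk
  rw [D_eq]
  simp only [map_mul, toAdd_mul, h]
  omega

lemma center_nonneg
    (hc : ∀ i j, i + 1 < j → Commute (s i) (s j))
    (hb : ∀ i, i + 1 < m → s i * s (i + 1) * s i = s (i + 1) * s i * s (i + 1))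
    (hone : ∀ k < m, (1 : G) ∉ P s k)
    (htri : ∀ g : G, g = 1 ∨ (∃ k < m, g ∈ P s k) ∨ (∃ k < m, g⁻¹ ∈ P s k))
    (e : G →* Multiplicative ℤ) (he : ∀ k < m, (e (s k)).toAdd = 1)
    {k : ℕ} (hk : k < m) {z : G} (hz : z ∈ H s (k+1))
    (hcz : ∀ g ∈ H s (k+1), Commute z g) (hpos : ¬ ∃ j < m, z⁻¹ ∈ P s j) :
    0 ≤ (e z).toAdd := by
  cases k with
  | zero =>
    obtain ⟨u, rfl⟩ := H_one hz
    rw [map_zpow, toAdd_zpow, he 0 hk]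
    by_contra hlt
    refine hpos ⟨0, hk, ?_⟩
    rw [← zpow_neg]
    refine zpow_mem_P (s_mem_P 0) ?_
    simp at hlt; omega
  | succ k =>
    obtain ⟨a, y, hy, rfl⟩ := cent hc hb hone htri hk hz
      (fun g hg => hcz g (H_mono (by omega) hg))
    have hyc : ∀ g ∈ H s (k+1+1), Commute y g := by
      intro g hg
      have h1 := (D_central hc hb (k := k+1+1) hk hg).zpow_left (-a)
      have := h1.mul_left (hcz g hg)
      simpa using this
    have hsh : ∀ y : G, y ∈ H s (k+1) → (∀ g ∈ H s (k+1+1), Commute y g) →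
        ∀ j < m, y ∉ P s j := by
      intro y hy hyc j hj h
      have hlt := pos_low hone hj hy h
      have h2 := P_shift hc hb hk hlt h
      rw [← (hyc _ (d_mem _)).eq, mul_inv_cancel_right] at h2
      exact notmem hone (by omega) (P_le_H h) h2
    have hy1 : y = 1 := by
      rcases htri y with h | ⟨j, hj, h⟩ | ⟨j, hj, h⟩
      · exact h
      · exact absurd h (hsh y hy hyc j hj)
      · exact absurd h (hsh _ (inv_mem hy) (fun g hg => (hyc g hg).inv_left) j hj)
    subst hy1
    have hD := e_D' e he (k+1) hk
    rw [mul_one, map_zpow, toAdd_zpow, smul_eq_mul]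
    refine mul_nonneg ?_ hD.le
    by_contra hlt
    refine hpos ⟨k+1, hk, ?_⟩
    rw [mul_one, ← zpow_neg]
    exact zpow_mem_P (D_mem_P _) (by omega)

theorem no_least
    (hc : ∀ i j, i + 1 < j → Commute (s i) (s j))
    (hb : ∀ i, i + 1 < m → s i * s (i + 1) * s i = s (i + 1) * s i * s (i + 1))
    (hone : ∀ k < m, (1 : G) ∉ P s k)
    (htri : ∀ g : G, g = 1 ∨ (∃ k < m, g ∈ P s k) ∨ (∃ k < m, g⁻¹ ∈ P s k))
    (hdisj : ∀ g : G, (∃ k < m, g ∈ P s k) → (∃ k < m, g⁻¹ ∈ P s k) → False)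
    (e : G →* Multiplicative ℤ) (he : ∀ k < m, (e (s k)).toAdd = 1)
    (N : Subgroup G) (hN : N.Normal) (hNe : ∀ g ∈ N, (e g).toAdd = 0)
    {β : G} (hβ : β ∈ N) {k : ℕ} (hk : k < m) (hβP : β ∈ P s k)
    (hmin : ∀ γ ∈ N, (∃ j < m, γ ∈ P s j) → γ = β ∨ ∃ j < m, β⁻¹ * γ ∈ P s j) : False := by
  have hβm := P_le_H hβP
  have hβe := hNe β hβ
  have hmin' : ∀ γ ∈ N, (∃ j < m, γ ∈ P s j) → (∃ j < m, γ⁻¹ * β ∈ P s j) → False := by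
    intro γ hγ h1 h2
    rcases hmin γ hγ h1 with rfl | h
    · obtain ⟨j, hj, h2⟩ := h2
      exact hone j hj (by simpa using h2)
    · refine hdisj _ h ?_
      simpa using h2
  have hint : ∀ γ ∈ N, γ ∈ H s k → γ = 1 := by
    intro γ hγ hγk
    rcases htri γ with h | h | h
    · exact h
    · exact (hmin' γ hγ h ⟨k, hk, QP (H_le_Q (inv_mem hγk)) hβP⟩).elim
    · exact (hmin' γ⁻¹ (inv_mem hγ) h ⟨k, hk, by
        rw [inv_inv]; exact QP (H_le_Q hγk) hβP⟩).elim
  have hxN : ∀ g : G, β⁻¹ * (g * β * g⁻¹) ∈ N := fun g =>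
    mul_mem (inv_mem hβ) (hN.conj_mem β hβ g)
  have hge : ∀ g ∈ H s k, (β⁻¹ * (g * β * g⁻¹))⁻¹ ∉ P s k := by
    intro g hg h
    refine hmin' (g * β * g⁻¹) (hN.conj_mem β hβ g)
      ⟨k, hk, PQ (QP (H_le_Q hg) hβP) (H_le_Q (inv_mem hg))⟩ ⟨k, hk, ?_⟩
    convert h using 1
    group
  have hcomm : ∀ g ∈ H s k, Commute β g := by
    intro g hg
    have hg' := H_mono (Nat.le_succ k) hg
    have hx1 : β⁻¹ * (g * β * g⁻¹) = 1 := by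
      rcases tri hone htri (k := k) (g := β⁻¹ * (g * β * g⁻¹))
        (mul_mem (inv_mem hβm) (mul_mem (mul_mem hg' hβm) (inv_mem hg'))) with h | h | h
      · exact hint _ (hxN g) h
      · exfalso
        refine hge g⁻¹ (inv_mem hg) ?_
        have := PQ (QP (H_le_Q (inv_mem hg)) h) (H_le_Q hg)
        convert this using 1
        group
      · exact absurd h (hge g hg)
    rw [inv_mul_eq_one, eq_mul_inv_iff_mul_eq] at hx1
    exact hx1
  cases k with
  | zero =>
    obtain ⟨u, rfl⟩ := H_one hβm
    rw [map_zpow, toAdd_zpow, he 0 hk] at hβe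
    have : u = 0 := by simpa using hβe
    subst this
    exact hone 0 hk (by simpa using hβP)
  | succ k =>
    obtain ⟨a, z, hz, hβz⟩ := cent hc hb hone htri hk hβm hcomm
    have hEc : ∀ g ∈ H s (k+1+1), Commute (D s (k+1+1)) g :=
      fun g hg => D_central hc hb hk hg
    have hEP : D s (k+1+1) ∈ P s (k+1) := D_mem_P (k+1)
    have ha : 0 < a := by
      by_contra hle
      rcases (not_lt.1 hle).lt_or_eq with h | h
      · have h1 := QP (P_le_Q (zpow_mem_P hEP (n := -a) (by omega))) hβP
        rw [hβz] at h1
        exact notmem hone hk hz (by simpa using h1)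
      · subst h
        exact notmem hone hk hz (by simpa [hβz] using hβP)
    have hzc : ∀ g ∈ H s (k+1), Commute z g := by
      intro g hg
      have h1 := (hEc g (H_mono (by omega) hg)).zpow_left (-a)
      have h2 := hcomm g hg
      rw [hβz] at h2
      simpa using h1.mul_left h2
    have hzpos : ¬ ∃ j < m, z⁻¹ ∈ P s j := by
      rintro ⟨j, hj, h⟩
      have hlt := pos_low hone hj (inv_mem hz) h
      set dd := d s (k+1+1) with hdd
      have hdm : dd ∈ H s (k+1+1) := d_mem _
      have hconj : dd * β * dd⁻¹ = D s (k+1+1) ^ a * (dd * z * dd⁻¹) := by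
        have := ((hEc dd hdm).zpow_left a).eq
        rw [hβz, ← mul_assoc dd, ← this]; group
      have hDd : D s (k+1+1) * dd⁻¹ = D s (k+1) * s (k+1) * A s (k+1) * (d s (k+1))⁻¹ := by
        rw [D_eq, hdd]
        change _ * (d s (k+1) * s (k+1))⁻¹ = _
        group
      have hQ1 : dd ∈ Q s (k+1) := mul_mem (H_le_Q (d_mem _)) (s_mem_Q _)
      have hcP : dd * β * dd⁻¹ ∈ P s (k+1) := by
        have e1 : dd * β * dd⁻¹ = D s (k+1+1) ^ (a-1) * dd * z * D s (k+1) * s (k+1) *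
            (A s (k+1) * (d s (k+1))⁻¹) := by
          have hzz := (hEc (dd * z) (mul_mem hdm (H_mono (by omega) hz))).eq
          calc dd * β * dd⁻¹ = D s (k+1+1) ^ (a-1) * (D s (k+1+1) * (dd * z)) * dd⁻¹ := by
                rw [hconj, zpow_sub_one]; group
            _ = D s (k+1+1) ^ (a-1) * dd * z * (D s (k+1+1) * dd⁻¹) := by rw [hzz]; group
            _ = _ := by rw [hDd]; group
        rw [e1]
        refine ⟨_, ?_, _, ?_, rfl⟩
        · refine mul_mem (mul_mem (mul_mem ?_ hQ1) (H_le_Q hz)) (H_le_Q (D_mem _))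
          obtain ⟨b, hb⟩ : ∃ b : ℕ, a - 1 = b := ⟨(a-1).toNat, by omega⟩
          rw [hb, zpow_natCast]
          exact pow_mem (P_le_Q hEP) _
        · exact mul_mem (H_le_Q (A_mem _)) (H_le_Q (inv_mem (d_mem _)))
      refine hmin' _ (hN.conj_mem β hβ dd) ⟨k+1, hk, hcP⟩ ⟨j+1, by omega, ?_⟩
      have h2 := P_shift hc hb hk hlt h
      have hzj : z ∈ H s (j+1) := inv_mem_iff.1 (P_le_H h)
      convert PQ h2 (H_le_Q hzj) using 1
      rw [hconj, hβz, ← hdd]; group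
    have hez := center_nonneg hc hb hone htri e he (by omega) hz hzc hzpos
    have hD := e_D' e he (k+1) hk
    rw [hβz, map_mul, toAdd_mul, map_zpow, toAdd_zpow, smul_eq_mul] at hβe
    nlinarith

end Abstract

section Bridge

variable {n : ℕ}

/-- generators, extended by `1` -/
def gs (n : ℕ) (k : ℕ) : BraidGroup n :=
  if h : k < n - 1 then PresentedGroup.of ⟨k, h⟩ else 1

lemma gs_val (i : Fin (n-1)) : gs n i = PresentedGroup.of i := by simp [gs]

/-- value of a word -/
def val (L : List (Fin (n-1) × Bool)) : BraidGroup n :=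
  PresentedGroup.mk (braidRels (n-1)) (FreeGroup.mk L)

lemma val_append (L M : List (Fin (n-1) × Bool)) : val (L ++ M) = val L * val M := by
  simp [val, ← FreeGroup.mul_mk]

lemma val_nil : val ([] : List (Fin (n-1) × Bool)) = 1 := by
  simp [val, ← FreeGroup.one_eq_mk]

lemma val_inv (L : List (Fin (n-1) × Bool)) : val (FreeGroup.invRev L) = (val L)⁻¹ := by
  simp [val, ← FreeGroup.inv_mk]

lemma val_true (i : Fin (n-1)) : val [(i, true)] = gs n i := by
  rw [gs_val]; rfl

lemma val_false (i : Fin (n-1)) : val [(i, false)] = (gs n i)⁻¹ := by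
  rw [← val_true, ← val_inv]; rfl

def Good (i : Fin (n-1)) (L : List (Fin (n-1) × Bool)) : Prop :=
  ∀ l ∈ L, l.1 ≤ i ∧ (l.1 = i → l.2 = true)

lemma Good_val (i : Fin (n-1)) (L : List (Fin (n-1) × Bool)) (h : Good i L) :
    val L ∈ Q (gs n) i ∧ ((∃ l ∈ L, l.1 = i) → val L ∈ P (gs n) i) := by
  induction L with
  | nil => exact ⟨by rw [val_nil]; exact one_mem _, by simp⟩
  | cons l L ih =>
    obtain ⟨h1, h2⟩ := ih (fun x hx => h x (List.mem_cons_of_mem _ hx))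
    obtain ⟨hl1, hl2⟩ := h l List.mem_cons_self
    have e : val (l :: L) = val [l] * val L := by rw [← val_append]; rfl
    have hcase : (l.1 = i ∧ val [l] ∈ P (gs n) i) ∨ (l.1 ≠ i ∧ val [l] ∈ H (gs n) i) := by
      obtain ⟨a, b⟩ := l
      by_cases ha : a = i
      · left
        have : b = true := hl2 ha
        subst this; subst ha
        exact ⟨rfl, by rw [val_true]; exact s_mem_P _⟩
      · right
        refine ⟨ha, ?_⟩
        have hlt : (a : ℕ) < i := lt_of_le_of_ne hl1 (fun h => ha (Fin.ext h))
        cases b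
        · rw [val_false]; exact inv_mem (s_mem_H hlt)
        · rw [val_true]; exact s_mem_H hlt
    rw [e]
    rcases hcase with ⟨_, hp⟩ | ⟨hne, hp⟩
    · exact ⟨mul_mem (P_le_Q hp) h1, fun _ => PQ hp h1⟩
    · refine ⟨mul_mem (H_le_Q hp) h1, ?_⟩
      rintro ⟨x, hx, hxi⟩
      rcases List.mem_cons.1 hx with rfl | hx
      · exact absurd hxi hne
      · exact QP (H_le_Q hp) (h2 ⟨x, hx, hxi⟩)

lemma H_word (i : Fin (n-1)) {g : BraidGroup n} (hg : g ∈ H (gs n) i) :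
    ∃ L : List (Fin (n-1) × Bool), val L = g ∧ ∀ l ∈ L, l.1 < i := by
  induction hg using Subgroup.closure_induction with
  | mem y hy =>
    obtain ⟨j, hj, rfl⟩ := hy
    refine ⟨[(⟨j, by omega⟩, true)], val_true _, ?_⟩
    intro l hl
    rw [List.mem_singleton.1 hl]
    exact hj
  | one => exact ⟨[], val_nil, by simp⟩
  | mul a b _ _ ha hb =>
    obtain ⟨L, rfl, hL⟩ := ha
    obtain ⟨M, rfl, hM⟩ := hb
    refine ⟨L ++ M, val_append _ _, ?_⟩
    intro l hl
    rcases List.mem_append.1 hl with h | h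
    · exact hL l h
    · exact hM l h
  | inv a _ ha =>
    obtain ⟨L, rfl, hL⟩ := ha
    refine ⟨_, val_inv L, ?_⟩
    intro l hl
    simp only [FreeGroup.invRev, List.mem_reverse, List.mem_map] at hl
    obtain ⟨x, hx, rfl⟩ := hl
    exact hL x hx

lemma Good_append {i : Fin (n-1)} {L M : List (Fin (n-1) × Bool)} (hL : Good i L)
    (hM : Good i M) : Good i (L ++ M) := by
  intro l hl
  rcases List.mem_append.1 hl with h | h
  · exact hL l h
  · exact hM l h

lemma Q_word (i : Fin (n-1)) {g : BraidGroup n} (hg : g ∈ Q (gs n) i) :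
    ∃ L : List (Fin (n-1) × Bool), val L = g ∧ Good i L := by
  induction hg using Submonoid.closure_induction with
  | mem y hy =>
    rcases hy with hy | hy
    · obtain ⟨L, e, hL⟩ := H_word i hy
      exact ⟨L, e, fun l hl => ⟨(hL l hl).le, fun h => absurd h (hL l hl).ne⟩⟩
    · rw [Set.mem_singleton_iff.1 hy]
      refine ⟨[(i, true)], val_true _, ?_⟩
      intro l hl
      rw [List.mem_singleton.1 hl]
      simp
  | one => exact ⟨[], val_nil, by intro l hl; simp at hl⟩
  | mul a b _ _ ha hb =>
    obtain ⟨L, rfl, hL⟩ := ha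
    obtain ⟨M, rfl, hM⟩ := hb
    exact ⟨L ++ M, val_append _ _, Good_append hL hM⟩

/-- occurrences of generator `i` survive elementary reductions of good words -/
lemma step_keep {i : Fin (n-1)} {L M : List (Fin (n-1) × Bool)} (h : FreeGroup.Red L M)
    (hL : Good i L) (hi : ∃ l ∈ L, l.1 = i) : Good i M ∧ ∃ l ∈ M, l.1 = i := by
  induction h with
  | refl => exact ⟨hL, hi⟩
  | tail _ hst ih =>
    obtain ⟨h1, x, hx, hxi⟩ := ih
    cases hst with
    | @not L₁ L₂ a b =>
      refine ⟨fun l hl => h1 l ?_, ?_⟩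
      · simp only [List.mem_append, List.mem_cons] at hl ⊢; tauto
      · have ha : a ≠ i := by
          intro ha
          have e1 := (h1 (a, b) (by simp)).2 ha
          have e2 := (h1 (a, !b) (by simp)).2 ha
          simp only at e1 e2
          rw [e1] at e2
          simp at e2
        refine ⟨x, ?_, hxi⟩
        simp only [List.mem_append, List.mem_cons] at hx ⊢
        rcases hx with hx | rfl | rfl | hx
        · exact Or.inl hx
        · exact absurd hxi ha
        · exact absurd hxi ha
        · exact Or.inr hx

lemma ipos_iff (β : BraidGroup n) (i : Fin (n-1)) : IsIPositive β i ↔ β ∈ P (gs n) i := by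
  constructor
  · rintro ⟨w, rfl, h1, h2⟩
    have := (Good_val i w.toWord h1).2 h2
    rwa [val, FreeGroup.mk_toWord] at this
  · rintro ⟨x, hx, y, hy, rfl⟩
    obtain ⟨L, rfl, hL⟩ := Q_word i hx
    obtain ⟨M, rfl, hM⟩ := Q_word i hy
    have hs : Good i [(i, true)] := by
      intro l hl
      rw [List.mem_singleton.1 hl]
      simp
    refine ⟨FreeGroup.mk (L ++ [(i, true)] ++ M), ?_, ?_⟩
    · change val _ = _
      rw [val_append, val_append, val_true]
    · rw [FreeGroup.toWord_mk]
      exact step_keep FreeGroup.reduce.red (Good_append (Good_append hL hs) hM)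
        ⟨(i, true), by simp, rfl⟩

lemma dpos_iff (β : BraidGroup n) : DPos β ↔ ∃ k < n - 1, β ∈ P (gs n) k := by
  constructor
  · rintro ⟨i, hi⟩
    exact ⟨i, i.2, (ipos_iff β i).1 hi⟩
  · rintro ⟨k, hk, h⟩
    exact ⟨⟨k, hk⟩, (ipos_iff β ⟨k, hk⟩).2 h⟩

lemma gs_comm (i j : ℕ) (h : i + 1 < j) : Commute (gs n i) (gs n j) := by
  by_cases hj : j < n - 1
  · have hi : i < n - 1 := by omega
    have hr : FreeGroup.of (⟨i, hi⟩ : Fin (n-1)) * FreeGroup.of ⟨j, hj⟩ *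
        (FreeGroup.of ⟨i, hi⟩)⁻¹ * (FreeGroup.of ⟨j, hj⟩)⁻¹ ∈ braidRels (n-1) :=
      Or.inl ⟨_, _, h, rfl⟩
    have := PresentedGroup.one_of_mem hr
    simp only [map_mul, map_inv] at this
    rw [mul_inv_eq_one, mul_inv_eq_iff_eq_mul] at this
    simp only [gs, hi, hj, dif_pos]
    exact this
  · simp [gs, hj]

lemma gs_braid (i : ℕ) (h : i + 1 < n - 1) :
    gs n i * gs n (i+1) * gs n i = gs n (i+1) * gs n i * gs n (i+1) := by
  have hi : i < n - 1 := by omega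
  have hr : FreeGroup.of (⟨i, hi⟩ : Fin (n-1)) * FreeGroup.of ⟨i+1, h⟩ * FreeGroup.of ⟨i, hi⟩ *
      (FreeGroup.of ⟨i+1, h⟩ * FreeGroup.of ⟨i, hi⟩ * FreeGroup.of ⟨i+1, h⟩)⁻¹
      ∈ braidRels (n-1) := Or.inr ⟨_, _, rfl, rfl⟩
  have := PresentedGroup.one_of_mem hr
  rw [map_mul, map_inv, mul_inv_eq_one] at this
  simp only [map_mul] at this
  simp only [gs, hi, h, dif_pos]
  exact this

lemma exists_exp (n : ℕ) : ∃ e : BraidGroup n →* Multiplicative ℤ,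
    ∀ k < n - 1, (e (gs n k)).toAdd = 1 := by
  have hr : ∀ r ∈ braidRels (n-1),
      FreeGroup.lift (fun _ : Fin (n-1) => Multiplicative.ofAdd (1:ℤ)) r = 1 := by
    rintro r (⟨i, j, _, rfl⟩ | ⟨i, j, _, rfl⟩) <;> simp
  refine ⟨PresentedGroup.toGroup hr, ?_⟩
  intro k hk
  simp [gs, hk, PresentedGroup.toGroup.of]

end Bridge

end DOrd

/-- For `n ≥ 3`, any nontrivial normal subgroup `N ⊴ B_n` with `N ⊆ [B_n, B_n]` is densely
ordered by the Dehornoy ordering (no least positive element). -/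
theorem stmt_16 {n : ℕ} (hn : 3 ≤ n)
    (hmul : ∀ a b : BraidGroup n, DPos a → DPos b → DPos (a * b))
    (htri : ∀ a : BraidGroup n,
      (a = 1 ∧ ¬DPos a ∧ ¬DPos a⁻¹) ∨ (DPos a ∧ a ≠ 1 ∧ ¬DPos a⁻¹) ∨
      (DPos a⁻¹ ∧ a ≠ 1 ∧ ¬DPos a))
    (N : Subgroup (BraidGroup n)) (hNnormal : N.Normal) (hNnontriv : N ≠ ⊥)
    (hNsub : N ≤ commutator (BraidGroup n)) :
    (¬ ∃ β : BraidGroup n, β ∈ N ∧ DPos β ∧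
      ∀ γ : BraidGroup n, γ ∈ N → DPos γ → γ = β ∨ DLt β γ) ∧
    ∀ f g : BraidGroup n, f ∈ N → g ∈ N → DLt f g →
      ∃ h : BraidGroup n, h ∈ N ∧ DLt f h ∧ DLt h g := by
  classical
  have hone : ∀ k < n - 1, (1 : BraidGroup n) ∉ DOrd.P (DOrd.gs n) k := by
    intro k hk h
    have h1 : DPos (1 : BraidGroup n) := (DOrd.dpos_iff _).2 ⟨k, hk, h⟩
    rcases htri 1 with h2 | h2 | h2
    · exact h2.2.1 h1
    · exact h2.2.1 rfl
    · exact h2.2.1 rfl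
  have htri' : ∀ g : BraidGroup n, g = 1 ∨ (∃ k < n - 1, g ∈ DOrd.P (DOrd.gs n) k) ∨
      (∃ k < n - 1, g⁻¹ ∈ DOrd.P (DOrd.gs n) k) := by
    intro g
    rw [← DOrd.dpos_iff, ← DOrd.dpos_iff]
    rcases htri g with h | h | h
    · exact Or.inl h.1
    · exact Or.inr (Or.inl h.1)
    · exact Or.inr (Or.inr h.1)
  have hdisj : ∀ g : BraidGroup n, (∃ k < n - 1, g ∈ DOrd.P (DOrd.gs n) k) →
      (∃ k < n - 1, g⁻¹ ∈ DOrd.P (DOrd.gs n) k) → False := by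
    intro g
    rw [← DOrd.dpos_iff, ← DOrd.dpos_iff]
    intro h1 h2
    rcases htri g with h | h | h
    · exact h.2.1 h1
    · exact h.2.2 h2
    · exact h.2.2 h1
  obtain ⟨e, he⟩ := DOrd.exists_exp n
  have hNe : ∀ g ∈ N, (e g).toAdd = 0 := by
    intro g hg
    have h1 : e g = 1 := Abelianization.commutator_subset_ker e (hNsub hg)
    rw [h1]; rfl
  have main : ¬ ∃ β : BraidGroup n, β ∈ N ∧ DPos β ∧
      ∀ γ : BraidGroup n, γ ∈ N → DPos γ → γ = β ∨ DLt β γ := by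
    rintro ⟨β, hβ, hpos, hmin⟩
    obtain ⟨k, hk, hP⟩ := (DOrd.dpos_iff β).1 hpos
    refine DOrd.no_least DOrd.gs_comm DOrd.gs_braid hone htri' hdisj e he N hNnormal hNe
      hβ hk hP ?_
    intro γ hγ h
    rw [← DOrd.dpos_iff] at h ⊢
    exact hmin γ hγ h
  refine ⟨main, ?_⟩
  intro f g hf hg hfg
  by_contra hcon
  refine main ⟨f⁻¹ * g, mul_mem (inv_mem hf) hg, hfg, ?_⟩
  intro γ hγ hγp
  by_contra hn
  push Not at hn
  obtain ⟨hne, hnl⟩ := hn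
  refine hcon ⟨f * γ, mul_mem hf hγ, ?_, ?_⟩
  · simpa [DLt] using hγp
  · have h3 : (f * γ)⁻¹ * g = ((f⁻¹ * g)⁻¹ * γ)⁻¹ := by group
    unfold DLt at hnl ⊢
    rw [h3]
    rcases htri ((f⁻¹ * g)⁻¹ * γ) with h | h | h
    · exact absurd (inv_mul_eq_one.1 h.1).symm hne
    · exact absurd h.1 hnl
    · exact h.1
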